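/- Let f : ℝ → ℝ be a Schwartz function and let x ∈ ℝ. Then the principal value Hilbert transform H f(x) := lim_{ε→0⁺} (1/π) ∫_{{t : |x−t| ≥ ε}} f(t)/(x−t) dt exists, the conjugate Poisson integral v(x,y) = ∫_ℝ f(t) Q_y(x−t) dt exists for every y > 0, and lim_{y→0⁺} v(x, y) = H f(x). -/

import Mathlib

open MeasureTheory Real Filter Topology SchwartzMap

/-- The conjugate Poisson kernel: `Q y x = x / (π (y² + x²))`. -/
noncomputable def conjPoissonKernel (y x : ℝ) : ℝ := x / (Real.pi * (y ^ 2 + x ^ 2))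

lemma SchwartzMap.exists_abs_sub_le (f : 𝓢(ℝ, ℝ)) :
    ∃ C : ℝ, 0 ≤ C ∧ ∀ a b : ℝ, |f a - f b| ≤ C * |a - b| := by
  obtain ⟨C, hC⟩ := f.decay 0 1
  have hC' : ∀ t, ‖fderiv ℝ f t‖ ≤ C := fun t => by
    simpa [norm_iteratedFDeriv_one] using hC.2 t
  refine ⟨C, hC.1.le, fun a b => ?_⟩
  exact convex_univ.norm_image_sub_le_of_norm_fderiv_le (𝕜 := ℝ)
    (fun t _ => f.differentiableAt) (fun t _ => hC' t) (Set.mem_univ b) (Set.mem_univ a)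

/-- The integrand of the symmetrized Hilbert transform, which has no singularity at `0`. -/
noncomputable def symmQuotient (f : 𝓢(ℝ, ℝ)) (x s : ℝ) : ℝ := (f (x - s) - f (x + s)) / (2 * s)

lemma integrable_symmQuotient (f : 𝓢(ℝ, ℝ)) (x : ℝ) : Integrable (symmQuotient f x) := by
  obtain ⟨C, hC0, hC⟩ := f.exists_abs_sub_le
  have hf : Measurable f := f.continuous.measurable
  have hbound : Integrable (fun s : ℝ =>
      (Set.Icc (-1 : ℝ) 1).indicator (fun _ => C) s + (‖f (x - s)‖ + ‖f (x + s)‖)) := by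
    refine Integrable.add ?_ (Integrable.add ?_ ?_)
    · exact (integrable_indicator_iff measurableSet_Icc).2 (integrableOn_const (by simp))
    · exact (f.integrable.comp_sub_left x).norm
    · exact (f.integrable.comp_add_left x).norm
  refine hbound.mono' ?_ (Eventually.of_forall fun s => ?_)
  · unfold symmQuotient
    exact Measurable.aestronglyMeasurable (by fun_prop)
  · simp only [symmQuotient, norm_eq_abs, abs_div]
    by_cases hs : s ∈ Set.Icc (-1 : ℝ) 1
    · rw [Set.indicator_of_mem hs]
      have h : |f (x - s) - f (x + s)| / |2 * s| ≤ C := by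
        refine div_le_of_le_mul₀ (abs_nonneg _) hC0 ((hC _ _).trans_eq ?_)
        rw [show x - s - (x + s) = -(2 * s) by ring, abs_neg]
      linarith [abs_nonneg (f (x - s)), abs_nonneg (f (x + s))]
    · rw [Set.indicator_of_notMem hs, zero_add]
      have h1 : 1 ≤ |2 * s| := by
        by_contra! h
        rw [abs_lt] at h
        exact hs ⟨by linarith, by linarith⟩
      exact (div_le_self (abs_nonneg _) h1).trans (abs_sub _ _)

lemma integrable_mul_comp_sub_left (f : 𝓢(ℝ, ℝ)) (x : ℝ) {k : ℝ → ℝ} (hk : Measurable k)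
    {C : ℝ} (hC : ∀ s, |k s| ≤ C) : Integrable (fun t => f t * k (x - t)) :=
  f.integrable.mul_bdd (c := C) (Measurable.aestronglyMeasurable (by fun_prop))
    (Eventually.of_forall fun t => hC (x - t))

lemma integral_mul_comp_sub_left_of_odd (f : 𝓢(ℝ, ℝ)) (x : ℝ) {k : ℝ → ℝ} (hk : Measurable k)
    {C : ℝ} (hC : ∀ s, |k s| ≤ C) (hodd : ∀ s, k (-s) = -k s) :
    ∫ t, f t * k (x - t) = ∫ s, symmQuotient f x s * (s * k s) := by
  have hint := integrable_mul_comp_sub_left f x hk hC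
  have hi1 : Integrable (fun s => f (x - s) * k s) := by
    simpa using hint.comp_sub_left x
  have hi2 : Integrable (fun s => f (x + s) * k s) := by
    simpa [hodd] using hi1.comp_neg
  have h1 : ∫ t, f t * k (x - t) = ∫ s, f (x - s) * k s := by
    simpa using (integral_sub_left_eq_self (fun t => f t * k (x - t)) volume x).symm
  have h2 : ∫ s, f (x - s) * k s = -∫ s, f (x + s) * k s := by
    rw [← integral_neg_eq_self, ← integral_neg]
    simp [hodd]
  have h3 : ∫ s, symmQuotient f x s * (s * k s)
      = ∫ s, (1 / 2) * (f (x - s) * k s - f (x + s) * k s) := by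
    congr 1 with s
    rcases eq_or_ne s 0 with rfl | hs
    · simp
    · simp only [symmQuotient]
      field_simp
  rw [h3, integral_const_mul, integral_sub hi1 hi2]
  linarith

lemma tendsto_integral_mul_comp_sub_left (f : 𝓢(ℝ, ℝ)) (x : ℝ) {k : ℝ → ℝ → ℝ}
    (hk : ∀ ε, Measurable (k ε)) (hC : ∀ ε, 0 < ε → ∃ C, ∀ s, |k ε s| ≤ C)
    (hodd : ∀ ε s, k ε (-s) = -k ε s) (hle : ∀ ε s, |s * k ε s| ≤ 1)
    (hlim : ∀ s, s ≠ 0 → Tendsto (fun ε => s * k ε s) (𝓝[>] 0) (𝓝 1)) :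
    Tendsto (fun ε => ∫ t, f t * k ε (x - t)) (𝓝[>] 0) (𝓝 (∫ s, symmQuotient f x s)) := by
  have hD := integrable_symmQuotient f x
  have hlim' : Tendsto (fun ε => ∫ s, symmQuotient f x s * (s * k ε s)) (𝓝[>] 0)
      (𝓝 (∫ s, symmQuotient f x s)) := by
    refine tendsto_integral_filter_of_dominated_convergence (fun s => ‖symmQuotient f x s‖)
      (Eventually.of_forall fun ε => ?_) (Eventually.of_forall fun ε =>
        Eventually.of_forall fun s => ?_) hD.norm ?_
    · have := hk ε
      exact hD.aestronglyMeasurable.mul (Measurable.aestronglyMeasurable (by fun_prop))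
    · rw [norm_mul]
      exact mul_le_of_le_one_right (norm_nonneg _) (hle ε s)
    · filter_upwards [Measure.ae_ne volume (0 : ℝ)] with s hs
      simpa using (hlim s hs).const_mul (symmQuotient f x s)
  refine hlim'.congr' ?_
  filter_upwards [self_mem_nhdsWithin] with ε hε
  obtain ⟨C, hC⟩ := hC ε hε
  exact (integral_mul_comp_sub_left_of_odd f x (hk ε) hC (hodd ε)).symm

lemma tendsto_setIntegral_div_sub (f : 𝓢(ℝ, ℝ)) (x : ℝ) :
    Tendsto (fun ε : ℝ => ∫ t in {t : ℝ | ε ≤ |x - t|}, f t / (x - t)) (𝓝[>] 0)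
      (𝓝 (∫ s, symmQuotient f x s)) := by
  have hset (ε : ℝ) : MeasurableSet {s : ℝ | ε ≤ |s|} :=
    measurableSet_le measurable_const continuous_abs.measurable
  have hset' (ε : ℝ) : MeasurableSet {t : ℝ | ε ≤ |x - t|} :=
    measurableSet_le measurable_const (by fun_prop)
  have := tendsto_integral_mul_comp_sub_left f x
    (k := fun ε => {s : ℝ | ε ≤ |s|}.indicator fun s => s⁻¹)
    (fun ε => measurable_inv.indicator (hset ε)) (fun ε hε => ⟨ε⁻¹, fun s => ?_⟩)
    (fun ε s => ?_) (fun ε s => ?_) (fun s hs => ?_)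
  · refine this.congr fun ε => ?_
    rw [← integral_indicator (hset' ε)]
    congr 1 with t
    by_cases h : ε ≤ |x - t| <;> simp [Set.indicator, h, div_eq_mul_inv]
  · by_cases h : ε ≤ |s|
    · simpa [Set.indicator, h, abs_inv] using inv_anti₀ hε h
    · simpa [Set.indicator, h] using hε.le
  · by_cases h : ε ≤ |s| <;> simp [Set.indicator, h, inv_neg]
  · rcases eq_or_ne s 0 with rfl | hs
    · simp
    · by_cases h : ε ≤ |s| <;> simp [Set.indicator, h, hs]
  · refine tendsto_const_nhds.congr' ?_
    filter_upwards [nhdsWithin_le_nhds (Iio_mem_nhds (abs_pos.2 hs))] with ε hε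
    simp [Set.indicator, (Set.mem_Iio.1 hε).le, hs]

lemma measurable_conjPoissonKernel (y : ℝ) : Measurable (conjPoissonKernel y) := by
  unfold conjPoissonKernel
  fun_prop

lemma conjPoissonKernel_neg (y s : ℝ) : conjPoissonKernel y (-s) = -conjPoissonKernel y s := by
  simp [conjPoissonKernel, neg_div]

lemma pi_mul_conjPoissonKernel (y s : ℝ) : π * conjPoissonKernel y s = s / (y ^ 2 + s ^ 2) := by
  unfold conjPoissonKernel
  rw [← mul_div_assoc, mul_div_mul_left _ _ pi_ne_zero]

lemma abs_pi_mul_conjPoissonKernel_le {y : ℝ} (hy : 0 < y) (s : ℝ) :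
    |π * conjPoissonKernel y s| ≤ y⁻¹ := by
  rw [pi_mul_conjPoissonKernel, abs_div, abs_of_pos (by positivity : 0 < y ^ 2 + s ^ 2),
    div_le_iff₀ (by positivity), inv_mul_eq_div, le_div_iff₀ hy]
  nlinarith [sq_abs s, sq_nonneg (|s| - y)]

lemma tendsto_integral_mul_conjPoissonKernel (f : 𝓢(ℝ, ℝ)) (x : ℝ) :
    Tendsto (fun y : ℝ => ∫ t, f t * (π * conjPoissonKernel y (x - t))) (𝓝[>] 0)
      (𝓝 (∫ s, symmQuotient f x s)) := by
  refine tendsto_integral_mul_comp_sub_left f x (k := fun y s => π * conjPoissonKernel y s)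
    (fun y => (measurable_conjPoissonKernel y).const_mul π)
    (fun y hy => ⟨y⁻¹, abs_pi_mul_conjPoissonKernel_le hy⟩)
    (fun y s => by rw [conjPoissonKernel_neg, mul_neg]) (fun y s => ?_) (fun s hs => ?_)
  · rw [pi_mul_conjPoissonKernel, ← mul_div_assoc, abs_of_nonneg (div_nonneg (mul_self_nonneg s) (by positivity))]
    · exact div_le_one_of_le₀ (by nlinarith [sq_nonneg y]) (by positivity)
  · simp only [pi_mul_conjPoissonKernel]
    have hcont : ContinuousAt (fun y : ℝ => s * (s / (y ^ 2 + s ^ 2))) 0 := by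
      have : (0 : ℝ) ^ 2 + s ^ 2 ≠ 0 := by simpa using hs
      fun_prop (disch := assumption)
    have h0 : s * (s / ((0 : ℝ) ^ 2 + s ^ 2)) = 1 := by field_simp; simp
    simpa only [h0] using hcont.tendsto.mono_left nhdsWithin_le_nhds

theorem hilbert_transform_boundary_value_of_conjugate_poisson
    (f : 𝓢(ℝ, ℝ)) (x : ℝ) :
    ∃ L : ℝ,
      Tendsto (fun ε : ℝ => (1 / Real.pi) * ∫ t in {t : ℝ | ε ≤ |x - t|}, f t / (x - t))
        (𝓝[>] 0) (𝓝 L) ∧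
      (∀ y : ℝ, 0 < y →
        Integrable (fun t : ℝ => f t * conjPoissonKernel y (x - t)) volume) ∧
      Tendsto (fun y : ℝ => ∫ t : ℝ, f t * conjPoissonKernel y (x - t)) (𝓝[>] 0) (𝓝 L) := by
  have hkernel (y t : ℝ) : f t * conjPoissonKernel y (x - t)
      = (1 / π) * (f t * (π * conjPoissonKernel y (x - t))) := by
    field_simp
  refine ⟨(1 / π) * ∫ s, symmQuotient f x s, (tendsto_setIntegral_div_sub f x).const_mul _,
    fun y hy => ?_, ?_⟩
  · simp only [hkernel]
    exact (integrable_mul_comp_sub_left f x ((measurable_conjPoissonKernel y).const_mul π)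
      (abs_pi_mul_conjPoissonKernel_le hy)).const_mul _
  · simp only [hkernel, integral_const_mul]
    exact (tendsto_integral_mul_conjPoissonKernel f x).const_mul _
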